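/- arXiv:1411.4226 — 4 statements merged into one kernel-verified Lean document; each statement's English description precedes it below -/
import Mathlib

section
/- (Lemma 1) With the notation of the rank-one perturbation setup, there exist ε₀ > 0 and a function f : ℝ → ℝ that is real-analytic on (−ε₀, ε₀) such that: for every ε with |ε| < ε₀, f(ε) equals the largest eigenvalue of the Hermitian positive semidefinite matrix H(ε); f(−ε) = f(ε) for all |ε| < ε₀; and as ε → 0, f(ε) = z + ‖b‖² ε² + z^{−1} · (b† (Z − b b†) b) · ε⁴ + o(ε⁴), where b† (Z − b b†) b denotes the (real, nonnegative) scalar b̄ᵀ(Z − b b†)b. -/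
open Matrix Finset Filter Topology Asymptotics ComplexOrder

open scoped ContDiff

/-- A Hermitian matrix has every eigenvalue of an explicit eigenvector among its `eigenvalues`. -/
lemma Matrix.IsHermitian.exists_eigenvalues_eq_of_mulVec {ι : Type*} [Fintype ι] [DecidableEq ι]
    {A : Matrix ι ι ℂ} (hA : A.IsHermitian) {v : ι → ℂ} (hv : v ≠ 0) {μ : ℂ}
    (h : A *ᵥ v = μ • v) : ∃ i, (hA.eigenvalues i : ℂ) = μ := by
  have hspec : μ ∈ spectrum ℂ A := by
    rw [← Matrix.spectrum_toLin']
    refine (Module.End.hasEigenvalue_of_hasEigenvector (x := v) ⟨?_, hv⟩).mem_spectrum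
    rw [Module.End.mem_eigenspace_iff, Matrix.toLin'_apply, h]
  rw [hA.spectrum_eq_image_range] at hspec
  obtain ⟨_, ⟨i, rfl⟩, hi⟩ := hspec
  exact ⟨i, hi⟩

/-- An eigenvalue of a positive semidefinite matrix exceeding half the trace is the largest one. -/
lemma Matrix.PosSemidef.re_eq_iSup_eigenvalues {ι : Type*} [Fintype ι] [DecidableEq ι]
    {A : Matrix ι ι ℂ} (hP : A.PosSemidef) (hA : A.IsHermitian) {v : ι → ℂ} (hv : v ≠ 0) {μ : ℂ}
    (h : A *ᵥ v = μ • v) (htr : A.trace.re < 2 * μ.re) : μ.re = ⨆ i, hA.eigenvalues i := by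
  obtain ⟨i, rfl⟩ := hA.exists_eigenvalues_eq_of_mulVec hv h
  have : Nonempty ι := ⟨i⟩
  rw [Complex.ofReal_re] at htr ⊢
  refine le_antisymm (le_ciSup (Set.finite_range _).bddAbove i) (ciSup_le fun j => ?_)
  by_contra! hlt
  have hij : i ≠ j := by rintro rfl; exact lt_irrefl _ hlt
  have hsum : hA.eigenvalues i + hA.eigenvalues j ≤ ∑ k, hA.eigenvalues k := by
    rw [← Finset.sum_pair hij]
    exact Finset.sum_le_sum_of_subset_of_nonneg (Finset.subset_univ _)
      fun k _ _ => hP.eigenvalues_nonneg k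
  have htrace : A.trace.re = ∑ k, hA.eigenvalues k := by
    rw [hA.trace_eq_sum_eigenvalues]; simp
  linarith

/-- The lower block of the eigenvector of the bordered matrix with corner `r ^ 2`, border `r • β`
and lower block `s • M` depends analytically on `s` near `0`. -/
lemma exists_analyticAt_bordered_eigenvector {m : ℕ} (β : Fin m → ℂ) (M : Matrix (Fin m) (Fin m) ℂ)
    {r : ℝ} (hr : r ≠ 0) :
    ∃ y : ℝ → Fin m → ℂ, AnalyticAt ℝ y 0 ∧ y 0 = r⁻¹ • β ∧
      ∀ᶠ s : ℝ in 𝓝 0, (r : ℂ) • β + (s : ℂ) • M *ᵥ y s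
        = ((r : ℂ) ^ 2 + (s : ℂ) * r * (star β ⬝ᵥ y s)) • y s := by
  let G : ℝ × (Fin m → ℂ) → Fin m → ℂ := fun p =>
    (r : ℂ) • β + (p.1 : ℂ) • M *ᵥ p.2 - ((r : ℂ) ^ 2 + (p.1 : ℂ) * r * (star β ⬝ᵥ p.2)) • p.2
  have hof : ContDiff ℝ ω (fun p : ℝ × (Fin m → ℂ) => (p.1 : ℂ)) :=
    Complex.ofRealCLM.contDiff.comp contDiff_fst
  have hG : ContDiff ℝ ω G := by
    refine contDiff_pi.2 fun i => ?_
    simp only [G, Pi.add_apply, Pi.sub_apply, Pi.smul_apply, smul_eq_mul, Matrix.mulVec, dotProduct]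
    fun_prop
  set p₀ : ℝ × (Fin m → ℂ) := (0, r⁻¹ • β) with hp₀
  have hG₀ : G p₀ = 0 := by
    ext i
    have : (r : ℂ) ≠ 0 := by exact_mod_cast hr
    simp [G, hp₀]
    field_simp
    simp
  have hr2 : -(r ^ 2) ≠ 0 := by simpa using hr
  have hd : fderiv ℝ G p₀ ∘L .inr ℝ ℝ (Fin m → ℂ)
      = (-(r ^ 2)) • ContinuousLinearMap.id ℝ (Fin m → ℂ) := by
    have h1 : HasFDerivAt (fun w : Fin m → ℂ => G (0, w))
        (fderiv ℝ G p₀ ∘L .inr ℝ ℝ (Fin m → ℂ)) (r⁻¹ • β) :=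
      (hG.contDiffAt.differentiableAt (by simp)).hasFDerivAt.comp _
        (hasFDerivAt_prodMk_right (0 : ℝ) (r⁻¹ • β))
    refine h1.unique ?_
    have h2 : (fun w : Fin m → ℂ => G (0, w)) = fun w => (r : ℂ) • β + (-(r ^ 2)) • w := by
      ext w i
      simp [G, sub_eq_add_neg]
    rw [h2]
    exact ((hasFDerivAt_id (𝕜 := ℝ) (r⁻¹ • β)).const_smul (-(r ^ 2))).const_add ((r : ℂ) • β)
  have hinv : (fderiv ℝ G p₀ ∘L .inr ℝ ℝ (Fin m → ℂ)).IsInvertible := by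
    rw [hd]
    refine ⟨ContinuousLinearEquiv.smulLeft (Units.mk0 _ hr2), ?_⟩
    ext w i
    simp [Units.smul_def]
  have hω : (ω : WithTop ℕ∞) ≠ 0 := by simp
  refine ⟨hG.contDiffAt.implicitFunction hω hinv,
    (hG.contDiffAt.contDiffAt_implicitFunction hω hinv).analyticAt,
    hG.contDiffAt.implicitFunction_apply_self hω hinv, ?_⟩
  filter_upwards [hG.contDiffAt.eventually_apply_implicitFunction hω hinv] with s hs
  rw [hG₀] at hs
  exact sub_eq_zero.1 hs

/-- First-order expansion of the solution `c` of `r * a + s * q s = (r ^ 2 + s * r * c s) * c s`. -/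
lemma deriv_of_quadratic_fixed_point {c q : ℝ → ℂ} {r a : ℂ} (hr : r ≠ 0)
    (hc : DifferentiableAt ℝ c 0) (hq : DifferentiableAt ℝ q 0)
    (h : ∀ᶠ s : ℝ in 𝓝 0, r * a + (s : ℂ) * q s = (r ^ 2 + (s : ℂ) * r * c s) * c s) :
    deriv c 0 = (q 0 - r * c 0 ^ 2) / r ^ 2 := by
  have hid : HasDerivAt (fun s : ℝ => (s : ℂ)) 1 0 := Complex.ofRealCLM.hasDerivAt
  have h1 := (hid.mul hq.hasDerivAt).const_add (r * a)
  have h2 := (((hid.mul_const r).mul hc.hasDerivAt).const_add (r ^ 2)).mul hc.hasDerivAt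
  have h3 := h1.unique (h2.congr_of_eventuallyEq h)
  simp at h3
  field_simp
  linear_combination -h3

/-- If `g` has derivative `g'` at `0`, then `a + ε² r g(ε²)` has the expected expansion. -/
lemma isLittleO_sq_mul_comp_sq {g : ℝ → ℝ} {g' : ℝ} (hg : HasDerivAt g g' 0) (r : ℝ) :
    (fun ε : ℝ => ε ^ 2 * r * g (ε ^ 2) - (r * g 0 * ε ^ 2 + r * g' * ε ^ 4))
      =o[𝓝 0] (fun ε : ℝ => ε ^ 4) := by
  have ht : Tendsto (fun ε : ℝ => ε ^ 2) (𝓝 0) (𝓝 0) := by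
    simpa using (continuous_pow 2).tendsto (0 : ℝ)
  have h1 := (hasDerivAt_iff_isLittleO.1 hg).comp_tendsto ht
  have h2 := ((isBigO_refl (fun ε : ℝ => ε ^ 2) (𝓝 0)).const_mul_left r).mul_isLittleO h1
  refine (h2.congr_left fun ε => ?_).congr_right fun ε => ?_
  · simp; ring
  · simp; ring

/-- **Lemma 1.** In the rank-one perturbation setup there are `ε₀ > 0` and a
function `f`, real-analytic on `(−ε₀, ε₀)`, with `f(ε)` the largest eigenvalue of the
Hermitian PSD matrix `H(ε)`, `f` even on `(−ε₀, ε₀)`, and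
`f(ε) = z + ‖b‖² ε² + z⁻¹ (b†(Z − b b†)b) ε⁴ + o(ε⁴)` as `ε → 0`. -/
theorem largest_eigenvalue_expansion_single
    (m n : ℕ) (hm : 1 ≤ m) (hn : 1 ≤ n)
    (u : Fin n → ℂ) (ξ : Fin n → Fin m → ℂ)
    (z : ℝ) (hz : z = ∑ j, ‖u j‖ ^ 2) (hzpos : 0 < z)
    (b : Fin m → ℂ)
    (hb : b = ((Real.sqrt z)⁻¹ : ℝ) • ∑ j, (starRingEnd ℂ) (u j) • ξ j)
    (Z : Matrix (Fin m) (Fin m) ℂ)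
    (hZ : Z = ∑ j, vecMulVec (ξ j) (star (ξ j)))
    (e₁ : Fin (m + 1) → ℂ) (he₁ : e₁ = Pi.single 0 1)
    (x : Fin n → ℝ → Fin (m + 1) → ℂ)
    (hx : ∀ j ε, x j ε = u j • e₁ + ε • (Fin.cons 0 (ξ j) : Fin (m + 1) → ℂ))
    (H : ℝ → Matrix (Fin (m + 1)) (Fin (m + 1)) ℂ)
    (hH : ∀ ε, H ε = ∑ j, vecMulVec (x j ε) (star (x j ε)))
    (hHerm : ∀ ε : ℝ, (H ε).IsHermitian)
    (hPSD : ∀ ε : ℝ, (H ε).PosSemidef)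
    (D : ℝ) (hD : (D : ℂ) = star b ⬝ᵥ (Z - vecMulVec b (star b)).mulVec b) :
    ∃ ε₀ > (0 : ℝ), ∃ f : ℝ → ℝ,
      AnalyticOnNhd ℝ f (Set.Ioo (-ε₀) ε₀) ∧
      (∀ ε : ℝ, |ε| < ε₀ → f ε = ⨆ i, (hHerm ε).eigenvalues i) ∧
      (∀ ε : ℝ, |ε| < ε₀ → f (-ε) = f ε) ∧
      (fun ε : ℝ => f ε - (z + (∑ i, ‖b i‖ ^ 2) * ε ^ 2 + z⁻¹ * D * ε ^ 4))
        =o[𝓝 0] (fun ε : ℝ => ε ^ 4) := by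
  set r := Real.sqrt z
  have hrpos : 0 < r := Real.sqrt_pos.2 hzpos
  have hrz : r ^ 2 = z := Real.sq_sqrt hzpos.le
  have hrC : (r : ℂ) ≠ 0 := by exact_mod_cast hrpos.ne'
  have hrzC : (r : ℂ) ^ 2 = z := by exact_mod_cast hrz
  have hsum : ∑ j, (starRingEnd ℂ) (u j) • ξ j = (r : ℂ) • b := by
    rw [hb]
    ext i
    simp [hrC]
  have hsumstar (w : Fin m → ℂ) : ∑ j, u j * (star (ξ j) ⬝ᵥ w) = r * (star b ⬝ᵥ w) := by
    have := congrArg (fun v => star v ⬝ᵥ w) hsum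
    simpa [sum_dotProduct] using this
  have hZmul (w : Fin m → ℂ) : Z *ᵥ w = ∑ j, (star (ξ j) ⬝ᵥ w) • ξ j := by
    simp [hZ, Matrix.sum_mulVec, Matrix.vecMulVec_mulVec]
  have hzC : ∑ j, u j * (starRingEnd ℂ) (u j) = z := by
    simp [hz, Complex.mul_conj, Complex.normSq_eq_norm_sq]
  obtain ⟨y, hya, hy0, hy⟩ := exists_analyticAt_bordered_eigenvector b Z hrpos.ne'
  have hcA (w : Fin m → ℂ) : AnalyticAt ℝ (fun s => w ⬝ᵥ y s) 0 := by
    have h1 (i : Fin m) : AnalyticAt ℝ (fun s => y s i) 0 := analyticAt_pi_iff.1 hya i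
    simp only [dotProduct]
    fun_prop
  set c : ℝ → ℂ := fun s => star b ⬝ᵥ y s with hc
  set g : ℝ → ℝ := fun s => (c s).re with hg
  have hgA : AnalyticAt ℝ g 0 := (Complex.reCLM.analyticAt _).comp (hcA _)
  have ht : Tendsto (fun ε : ℝ => ε ^ 2) (𝓝 0) (𝓝 0) := by
    simpa using (continuous_pow 2).tendsto (0 : ℝ)
  set f : ℝ → ℝ := fun ε => z + ε ^ 2 * r * g (ε ^ 2) with hf
  have hfA : AnalyticAt ℝ f 0 := by
    have h1 : AnalyticAt ℝ (fun ε : ℝ => g (ε ^ 2)) 0 := by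
      refine AnalyticAt.fun_comp (g := g) ?_ (by fun_prop)
      simpa using hgA
    exact analyticAt_const.add (((analyticAt_id.pow 2).mul analyticAt_const).mul h1)
  have heig (ε : ℝ) (h : (r : ℂ) • b + ((ε ^ 2 : ℝ) : ℂ) • Z *ᵥ y (ε ^ 2)
        = ((r : ℂ) ^ 2 + ((ε ^ 2 : ℝ) : ℂ) * r * c (ε ^ 2)) • y (ε ^ 2)) :
      H ε *ᵥ (Fin.cons 1 ((ε : ℂ) • y (ε ^ 2)) : Fin (m + 1) → ℂ)
        = ((z : ℂ) + (ε ^ 2 : ℝ) * r * c (ε ^ 2)) •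
          (Fin.cons 1 ((ε : ℂ) • y (ε ^ 2)) : Fin (m + 1) → ℂ) := by
    have hxcons (j : Fin n) : x j ε = Fin.cons (u j) ((ε : ℂ) • ξ j) := by
      rw [hx, he₁]
      ext i
      cases i using Fin.cases <;> simp
    have hdot (j : Fin n) : star (x j ε) ⬝ᵥ (Fin.cons 1 ((ε : ℂ) • y (ε ^ 2)) : Fin (m + 1) → ℂ)
        = (starRingEnd ℂ) (u j) + (ε : ℂ) ^ 2 * (star (ξ j) ⬝ᵥ y (ε ^ 2)) := by
      rw [hxcons]
      simp only [dotProduct, Fin.sum_univ_succ, Finset.mul_sum]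
      simp
      exact Finset.sum_congr rfl fun i _ => by ring
    have hH' : H ε *ᵥ (Fin.cons 1 ((ε : ℂ) • y (ε ^ 2)) : Fin (m + 1) → ℂ)
        = ∑ j, ((starRingEnd ℂ) (u j) + (ε : ℂ) ^ 2 * (star (ξ j) ⬝ᵥ y (ε ^ 2))) • x j ε := by
      simp only [hH, Matrix.sum_mulVec, Matrix.vecMulVec_mulVec, hdot, op_smul_eq_smul]
    rw [hH']
    ext i
    cases i using Fin.cases with
    | zero =>
      have h1 := hsumstar (y (ε ^ 2))
      simp only [hxcons, Finset.sum_apply, Pi.smul_apply, Fin.cons_zero, smul_eq_mul, mul_one]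
      rw [← hzC]
      push_cast
      rw [mul_assoc, ← h1, Finset.mul_sum, ← Finset.sum_add_distrib]
      exact Finset.sum_congr rfl fun j _ => by ring
    | succ i =>
      rw [hZmul, ← hsum, hrzC] at h
      have h1 := congrArg (fun v => (ε : ℂ) * v i) h
      simp only [hxcons, Finset.sum_apply, Pi.smul_apply, Fin.cons_succ, smul_eq_mul,
        Pi.add_apply] at h1 ⊢
      rw [Finset.mul_sum, ← Finset.sum_add_distrib, Finset.mul_sum] at h1
      push_cast at h1 ⊢
      linear_combination h1 + Finset.sum_congr (rfl : (univ : Finset (Fin n)) = univ)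
        fun j _ => (by ring : ((starRingEnd ℂ) (u j) + (ε : ℂ) ^ 2 * (star (ξ j) ⬝ᵥ y (ε ^ 2))) *
          ((ε : ℂ) * ξ j i) = (ε : ℂ) * ((starRingEnd ℂ) (u j) * ξ j i +
            (ε : ℂ) ^ 2 * ((star (ξ j) ⬝ᵥ y (ε ^ 2)) * ξ j i)))
  have htrace : ∀ᶠ ε : ℝ in 𝓝 0, (H ε).trace.re < 2 * f ε := by
    have hcont : Continuous fun ε : ℝ => (H ε).trace.re := by
      simp only [hH, Matrix.trace_sum, Matrix.trace_vecMulVec, hx]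
      fun_prop
    have h0 : (H 0).trace.re < 2 * f 0 := by
      have : (H 0).trace = z := by
        rw [← hzC]
        simp [hH, Matrix.trace_sum, Matrix.trace_vecMulVec, hx, he₁, mul_comm]
      simp [this, hf]
      linarith
    exact hcont.continuousAt.eventually_lt (continuousAt_const.mul hfA.continuousAt) h0
  have hev : ∀ᶠ ε : ℝ in 𝓝 0, AnalyticAt ℝ f ε ∧ f ε = ⨆ i, (hHerm ε).eigenvalues i := by
    filter_upwards [hfA.eventually_analyticAt, ht.eventually hy, htrace] with ε h1 h2 h3
    have hre : ((z : ℂ) + (ε ^ 2 : ℝ) * r * c (ε ^ 2)).re = f ε := by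
      rw [← Complex.ofReal_mul, Complex.add_re, Complex.re_ofReal_mul, Complex.ofReal_re]
    refine ⟨h1, ?_⟩
    rw [← hre] at h3 ⊢
    refine (hPSD ε).re_eq_iSup_eigenvalues (hHerm ε) (fun h => ?_) (heig ε h2) h3
    simpa using congrFun h 0
  obtain ⟨ε₀, hε₀, hball⟩ := Metric.eventually_nhds_iff.1 hev
  refine ⟨ε₀, hε₀, f, fun ε hε => (hball ?_).1, fun ε hε => (hball ?_).2, fun ε _ => ?_, ?_⟩
  · simpa [abs_lt] using hε
  · simpa using hε
  · simp [hf]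
  have hbb : star b ⬝ᵥ b = ((∑ i, ‖b i‖ ^ 2 : ℝ) : ℂ) := by
    simp [dotProduct, Complex.conj_mul']
  have hc0 : c 0 = (r : ℂ)⁻¹ * (star b ⬝ᵥ b) := by
    simp [hc, hy0, Complex.real_smul]
  have hq (s : ℝ) : star b ⬝ᵥ Z *ᵥ y s = (star b ᵥ* Z) ⬝ᵥ y s := Matrix.dotProduct_mulVec _ _ _
  have hc' : deriv c 0 = ((D / (r * z) : ℝ) : ℂ) := by
    rw [deriv_of_quadratic_fixed_point (q := fun s => star b ⬝ᵥ Z *ᵥ y s) (a := star b ⬝ᵥ b) hrC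
      (hcA _).differentiableAt (by simpa only [hq] using (hcA _).differentiableAt)]
    · have hq0 : star b ⬝ᵥ Z *ᵥ y 0 = (r : ℂ)⁻¹ * (star b ⬝ᵥ Z *ᵥ b) := by
        rw [hy0, Matrix.mulVec_smul, dotProduct_smul, Complex.real_smul, Complex.ofReal_inv]
      push_cast
      rw [hq0, show star b ⬝ᵥ y 0 = _ from hc0, hD, ← hrzC, Matrix.sub_mulVec, dotProduct_sub, Matrix.vecMulVec_mulVec]
      simp
      field_simp
    · filter_upwards [hy] with s hs
      simpa [dotProduct_add, dotProduct_smul] using congrArg (fun v => star b ⬝ᵥ v) hs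
  have hg' : HasDerivAt g (D / (r * z)) 0 := by
    have h1 := (hcA (star b)).differentiableAt.hasDerivAt
    rw [hc'] at h1
    exact Complex.reCLM.hasFDerivAt.comp_hasDerivAt 0 h1
  have hg0 : g 0 = r⁻¹ * ∑ i, ‖b i‖ ^ 2 := by
    simp only [hg]
    rw [hc0, hbb, ← Complex.ofReal_inv, ← Complex.ofReal_mul, Complex.ofReal_re]
  refine (isLittleO_sq_mul_comp_sq hg' r).congr_left fun ε => ?_
  simp only [hf]
  rw [hg0]
  field_simp
  ring
end

section
/- Let 1 ≤ k < m and let Σ, A be m×m complex Hermitian matrices, each partitioned into blocks Σ₁₁, Σ₁₂, Σ₂₁ = Σ₁₂†, Σ₂₂ and A₁₁, A₁₂, A₂₁ = A₁₂†, A₂₂ with Σ₁₁, A₁₁ of size k×k. Assume Σ, Σ₂₂, A₂₂ and the Schur complement Σ₁₁·₂ := Σ₁₁ − Σ₁₂ Σ₂₂^{−1} Σ₂₁ are invertible. Let A₁₁·₂ := A₁₁ − A₁₂ A₂₂^{−1} A₂₁. Then tr(Σ^{−1} A) = tr[ Σ₁₁·₂^{−1} (A₁₂ − Σ₁₂ Σ₂₂^{−1}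 A₂₂) A₂₂^{−1} (A₁₂ − Σ₁₂ Σ₂₂^{−1} A₂₂)† ] + tr[ A₂₂ Σ₂₂^{−1} ] + tr[ Σ₁₁·₂^{−1} A₁₁·₂ ]. -/
open Matrix

namespace Matrix

/-- The trace of a block matrix is the sum of the traces of its diagonal blocks. -/
theorem trace_fromBlocks {m n R : Type*} [Fintype m] [Fintype n] [AddCommMonoid R]
    (A : Matrix m m R) (B : Matrix m n R) (C : Matrix n m R) (D : Matrix n n R) :
    trace (fromBlocks A B C D) = trace A + trace D := by
  simp [trace, Fintype.sum_sum_type]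

/-- Expansion of the product `(B' - B D⁻¹ D') D'⁻¹ (C' - D' D⁻¹ C)`. -/
theorem sub_mul_inv_mul_sub {m n R : Type*} [Fintype n] [DecidableEq n] [CommRing R]
    (B B' : Matrix m n R) (C C' : Matrix n m R) (D D' : Matrix n n R) (hD' : IsUnit D'.det) :
    (B' - B * D⁻¹ * D') * D'⁻¹ * (C' - D' * D⁻¹ * C) =
      B' * D'⁻¹ * C' - B' * D⁻¹ * C - B * D⁻¹ * C' + B * D⁻¹ * D' * D⁻¹ * C := by
  simp only [Matrix.sub_mul, Matrix.mul_sub, Matrix.mul_assoc,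
    nonsing_inv_mul_cancel_left _ _ hD', mul_nonsing_inv_cancel_left _ _ hD']
  abel

variable {m n R : Type*} [Fintype m] [Fintype n] [DecidableEq m] [DecidableEq n] [CommRing R]

/-- The inverse of a block matrix in terms of the Schur complement of its lower right block. -/
theorem inv_fromBlocks_of_isUnit_det_schur (A : Matrix m m R) (B : Matrix m n R)
    (C : Matrix n m R) (D : Matrix n n R) (hD : IsUnit D.det)
    (hS : IsUnit (A - B * D⁻¹ * C).det) :
    (fromBlocks A B C D)⁻¹ =
      fromBlocks (A - B * D⁻¹ * C)⁻¹ (-((A - B * D⁻¹ * C)⁻¹ * B * D⁻¹))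
        (-(D⁻¹ * C * (A - B * D⁻¹ * C)⁻¹))
        (D⁻¹ + D⁻¹ * C * (A - B * D⁻¹ * C)⁻¹ * B * D⁻¹) := by
  let := invertibleOfIsUnitDet D hD
  simp only [← invOf_eq_nonsing_inv D] at hS ⊢
  let := invertibleOfIsUnitDet _ hS
  let := fromBlocks₂₂Invertible A B C D
  simpa only [invOf_eq_nonsing_inv] using invOf_fromBlocks₂₂_eq A B C D

/-- The trace of `M⁻¹ * M'` for block matrices, in terms of the Schur complements of the lower
right blocks. -/
theorem trace_inv_fromBlocks_mul_fromBlocks (A A' : Matrix m m R) (B B' : Matrix m n R)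
    (C C' : Matrix n m R) (D D' : Matrix n n R) (hD : IsUnit D.det) (hD' : IsUnit D'.det)
    (hS : IsUnit (A - B * D⁻¹ * C).det) :
    trace ((fromBlocks A B C D)⁻¹ * fromBlocks A' B' C' D') =
      trace ((A - B * D⁻¹ * C)⁻¹ *
          ((B' - B * D⁻¹ * D') * D'⁻¹ * (C' - D' * D⁻¹ * C))) +
        trace (D' * D⁻¹) +
        trace ((A - B * D⁻¹ * C)⁻¹ * (A' - B' * D'⁻¹ * C')) := by
  rw [inv_fromBlocks_of_isUnit_det_schur A B C D hD hS, sub_mul_inv_mul_sub B B' C C' D D' hD',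
    fromBlocks_multiply, trace_fromBlocks]
  generalize (A - B * D⁻¹ * C)⁻¹ = P
  have h₁ : trace (D⁻¹ * C * P * B') = trace (P * (B' * D⁻¹ * C)) := by
    rw [Matrix.mul_assoc, trace_mul_comm]
    simp only [Matrix.mul_assoc]
  have h₂ : trace (D⁻¹ * C * P * B * D⁻¹ * D') = trace (P * (B * D⁻¹ * D' * D⁻¹ * C)) := by
    rw [show D⁻¹ * C * P * B * D⁻¹ * D' = D⁻¹ * C * (P * B * D⁻¹ * D') by
      simp only [Matrix.mul_assoc], trace_mul_comm]
    simp only [Matrix.mul_assoc]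
  have h₃ : P * B * D⁻¹ * C' = P * (B * D⁻¹ * C') := by simp only [Matrix.mul_assoc]
  simp only [Matrix.add_mul, Matrix.neg_mul, Matrix.mul_add, Matrix.mul_sub, trace_add, trace_sub,
    trace_neg, h₁, h₂, h₃, trace_mul_comm D' D⁻¹]
  ring

end Matrix

/-- The trace decomposition `tr(Σ⁻¹A)` in terms of the Schur complements
`Σ₁₁·₂` and `A₁₁·₂` of Hermitian block matrices `Σ = [[Σ₁₁, Σ₁₂], [Σ₁₂ᴴ, Σ₂₂]]` and
`A = [[A₁₁, A₁₂], [A₁₂ᴴ, A₂₂]]`. -/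
theorem trace_schur_complement_decomposition
    (k m : ℕ) (hk : 1 ≤ k) (hkm : k < m)
    (S11 : Matrix (Fin k) (Fin k) ℂ) (S12 : Matrix (Fin k) (Fin (m - k)) ℂ)
    (S22 : Matrix (Fin (m - k)) (Fin (m - k)) ℂ)
    (A11 : Matrix (Fin k) (Fin k) ℂ) (A12 : Matrix (Fin k) (Fin (m - k)) ℂ)
    (A22 : Matrix (Fin (m - k)) (Fin (m - k)) ℂ)
    (hSherm : (fromBlocks S11 S12 S12ᴴ S22).IsHermitian)
    (hAherm : (fromBlocks A11 A12 A12ᴴ A22).IsHermitian)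
    (hSinv : IsUnit (fromBlocks S11 S12 S12ᴴ S22).det)
    (hS22inv : IsUnit S22.det)
    (hA22inv : IsUnit A22.det)
    (hSchurinv : IsUnit (S11 - S12 * S22⁻¹ * S12ᴴ).det) :
    trace ((fromBlocks S11 S12 S12ᴴ S22)⁻¹ * fromBlocks A11 A12 A12ᴴ A22) =
      trace ((S11 - S12 * S22⁻¹ * S12ᴴ)⁻¹ *
          ((A12 - S12 * S22⁻¹ * A22) * A22⁻¹ * (A12 - S12 * S22⁻¹ * A22)ᴴ)) +
        trace (A22 * S22⁻¹) +
        trace ((S11 - S12 * S22⁻¹ * S12ᴴ)⁻¹ * (A11 - A12 * A22⁻¹ * A12ᴴ)) := by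
  have hS22 : S22ᴴ = S22 := (isHermitian_fromBlocks_iff.mp hSherm).2.2.2
  have hA22 : A22ᴴ = A22 := (isHermitian_fromBlocks_iff.mp hAherm).2.2.2
  have h : (A12 - S12 * S22⁻¹ * A22)ᴴ = A12ᴴ - A22 * S22⁻¹ * S12ᴴ := by
    simp only [conjTranspose_sub, conjTranspose_mul, conjTranspose_nonsing_inv, hS22, hA22,
      Matrix.mul_assoc]
  rw [h]
  exact trace_inv_fromBlocks_mul_fromBlocks S11 A11 S12 A12 S12ᴴ A12ᴴ S22 A22
    hS22inv hA22inv hSchurinv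
end

section
/- Let m ≥ 2, let E be an invertible Hermitian m×m complex matrix, let z > 0 be real and b̂ ∈ ℂ^m a vector with first coordinate 0, and set A₁ := √z (e₁ b̂† + b̂ e₁†), E¹¹ := e₁† E^{−1} e₁, E^{b1} := b̂† E^{−1} e₁. Assume E¹¹ ≠ 0. Define w₀ := E^{−1} e₁, λ₀ := z E¹¹, λ₁ := 2√z Re(E^{b1}), and w₁ := z^{−1/2} ( E^{−1} b̂ − (conj(E^{b1}) / E¹¹) E^{−1} e₁ ). Then E^{−1} A₁ w₀ = λ₁ w₀ + λ₀ w₁, and e₁† w₁ = 0. -/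
open Matrix

/-- Conjugate symmetry of the sesquilinear form of a Hermitian matrix. -/
theorem dotProduct_mulVec_conj {n : Type*} [Fintype n] {M : Matrix n n ℂ} (hM : M.IsHermitian)
    (u v : n → ℂ) :
    (starRingEnd ℂ) (star u ⬝ᵥ M.mulVec v) = star v ⬝ᵥ M.mulVec u := by
  rw [starRingEnd_apply, star_dotProduct, star_star, star_mulVec, hM.eq, dotProduct_mulVec]

/-- With `w₀ = E⁻¹e₁`, `λ₀ = zE¹¹`, `λ₁ = 2√z Re(E^{b1})`, and
`w₁ = z^{−1/2}(E⁻¹b̂ − (conj(E^{b1})/E¹¹)E⁻¹e₁)`, one has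
`E⁻¹A₁w₀ = λ₁w₀ + λ₀w₁` and `e₁†w₁ = 0`. -/
theorem first_order_perturbation_equation_double
    (m : ℕ) (hm : 2 ≤ m)
    (i0 : Fin m) (hi0 : (i0 : ℕ) = 0)
    (E : Matrix (Fin m) (Fin m) ℂ) (hEherm : E.IsHermitian) (hEinv : IsUnit E.det)
    (z : ℝ) (hz : 0 < z)
    (e₁ : Fin m → ℂ) (he₁ : e₁ = Pi.single i0 1)
    (bhat : Fin m → ℂ) (hbhat0 : bhat i0 = 0)
    (A₁ : Matrix (Fin m) (Fin m) ℂ)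
    (hA₁ : A₁ = Real.sqrt z • (vecMulVec e₁ (star bhat) + vecMulVec bhat (star e₁)))
    (E11 : ℝ) (hE11 : (E11 : ℂ) = star e₁ ⬝ᵥ E⁻¹.mulVec e₁) (hE11ne : E11 ≠ 0)
    (Eb1 : ℂ) (hEb1 : Eb1 = star bhat ⬝ᵥ E⁻¹.mulVec e₁)
    (w₀ : Fin m → ℂ) (hw₀ : w₀ = E⁻¹.mulVec e₁)
    (lam0 : ℝ) (hlam0 : lam0 = z * E11)
    (lam1 : ℝ) (hlam1 : lam1 = 2 * Real.sqrt z * Eb1.re)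
    (w₁ : Fin m → ℂ)
    (hw₁ : w₁ = ((Real.sqrt z)⁻¹ : ℝ) •
      (E⁻¹.mulVec bhat - ((starRingEnd ℂ) Eb1 / (E11 : ℂ)) • E⁻¹.mulVec e₁)) :
    E⁻¹.mulVec (A₁.mulVec w₀) = lam1 • w₀ + lam0 • w₁ ∧
    star e₁ ⬝ᵥ w₁ = 0 := by
  have hs : Real.sqrt z ≠ 0 := (Real.sqrt_pos.2 hz).ne'
  have hsC : (Real.sqrt z : ℂ) ≠ 0 := by exact_mod_cast hs
  have hsq : (z : ℂ) = Real.sqrt z * Real.sqrt z := by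
    exact_mod_cast (Real.mul_self_sqrt hz.le).symm
  have hE : (E11 : ℂ) ≠ 0 := by exact_mod_cast hE11ne
  have hre : 2 * (Eb1.re : ℂ) = Eb1 + (starRingEnd ℂ) Eb1 := by
    rw [Complex.add_conj]; push_cast; ring
  have hcross : star e₁ ⬝ᵥ E⁻¹.mulVec bhat = (starRingEnd ℂ) Eb1 := by
    rw [hEb1, dotProduct_mulVec_conj hEherm.inv]
  constructor
  · have hA : A₁.mulVec w₀ = (Real.sqrt z : ℂ) • (Eb1 • e₁ + (E11 : ℂ) • bhat) := by
      rw [hA₁, hw₀, smul_mulVec, add_mulVec, vecMulVec_mulVec, vecMulVec_mulVec, ← hEb1, ← hE11]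
      simp only [op_smul_eq_smul]
      ext i
      simp [mul_add]
    rw [hA, mulVec_smul, mulVec_add, mulVec_smul, mulVec_smul, ← hw₀, hlam1, hlam0, hw₁, ← hw₀]
    ext i
    simp only [Pi.add_apply, Pi.sub_apply, Pi.smul_apply, smul_eq_mul, Complex.real_smul]
    push_cast
    rw [hsq, mul_right_comm 2, hre]
    field_simp
    ring
  · rw [hw₁, dotProduct_smul, dotProduct_sub, dotProduct_smul, hcross, ← hE11, smul_eq_mul,
      div_mul_cancel₀ _ hE, sub_self, smul_zero]
end

section
/- Let m ≥ 2 and n ≥ 1 be integers, u ∈ ℂⁿ with ‖u‖ > 0, v₁, …, vₙ ∈ ℂ^{m−1}, and σ ∈ ℝ. Define w₁ := (1/‖u‖) (0, v₁) ∈ ℂ^m, w₃ := (1/‖u‖³) (0, Σ_{j=2}^n vⱼ vⱼ† v₁) ∈ ℂ^m, and v̂ := e₁ + σ w₁ + σ³ w₃. Then the exact identity holds: |⟨v̂, e₁⟩|² / ‖v̂‖² = 1 / ( 1 + σ² ‖v₁‖²/‖u‖² + 2σ⁴ Σ_{j=2}^n |v₁† vⱼ|² / ‖u‖⁴ + σ⁶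 ‖Σ_{j=2}^n vⱼ vⱼ† v₁‖² / ‖u‖⁶ ). -/
open Matrix Finset

/-- Expansion of the squared Euclidean norm of a real linear combination of complex vectors. -/
theorem sum_norm_sq_real_combination {ι : Type*} [Fintype ι] (a b : ι → ℂ) (α β : ℝ) :
    ∑ i, ‖(α : ℂ) * a i + β * b i‖ ^ 2 =
      α ^ 2 * ∑ i, ‖a i‖ ^ 2 + 2 * α * β * (star a ⬝ᵥ b).re + β ^ 2 * ∑ i, ‖b i‖ ^ 2 := by
  simp only [dotProduct, Complex.re_sum, Finset.mul_sum, ← Finset.sum_add_distrib]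
  refine Finset.sum_congr rfl fun i _ => ?_
  simp only [Complex.sq_norm, Complex.normSq_apply, Pi.star_apply, Complex.star_def,
    Complex.add_re, Complex.add_im, Complex.mul_re, Complex.mul_im, Complex.ofReal_re,
    Complex.ofReal_im, Complex.conj_re, Complex.conj_im]
  ring

/-- The quadratic form of `∑ j ∈ s, v j (v j)†` at `a` is `∑ j ∈ s, |a† v j|²`. -/
theorem re_star_dotProduct_sum_smul {ι κ : Type*} [Fintype ι] (s : Finset κ) (a : ι → ℂ)
    (v : κ → ι → ℂ) :
    (star a ⬝ᵥ ∑ j ∈ s, (star (v j) ⬝ᵥ a) • v j).re = ∑ j ∈ s, ‖star a ⬝ᵥ v j‖ ^ 2 := by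
  rw [dotProduct_sum, Complex.re_sum]
  refine Finset.sum_congr rfl fun j _ => ?_
  rw [dotProduct_smul, smul_eq_mul, star_dotProduct (v j) a, Complex.sq_norm, Complex.star_def,
    ← Complex.normSq_eq_conj_mul_self, Complex.ofReal_re]

/-- With `v̂ = e₁ + σw₁ + σ³w₃`, where `w₁ = ‖u‖⁻¹(0, v₁)` and
`w₃ = ‖u‖⁻³(0, Σ_{j≥2} vⱼvⱼ†v₁)`, the exact identity
`|⟨v̂,e₁⟩|²/‖v̂‖² = 1/(1 + σ²‖v₁‖²/‖u‖² + 2σ⁴Σ_{j≥2}|v₁†vⱼ|²/‖u‖⁴ + σ⁶‖Σ_{j≥2}vⱼvⱼ†v₁‖²/‖u‖⁶)`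
holds (Euclidean norms are written out as sums; ambient dimension is `m + 1` with `1 ≤ m`). -/
theorem eigenvector_overlap_exact_identity
    (m n : ℕ) (hm : 1 ≤ m) (hn : 0 < n)
    (u : Fin n → ℂ) (σ : ℝ)
    (nu : ℝ) (hnu : nu = Real.sqrt (∑ j, ‖u j‖ ^ 2)) (hnupos : 0 < nu)
    (v : Fin n → Fin m → ℂ)
    (w : Fin m → ℂ)
    (hw : w = ∑ j ∈ Finset.univ.erase ⟨0, hn⟩, (star (v j) ⬝ᵥ v ⟨0, hn⟩) • v j)
    (e₁ : Fin (m + 1) → ℂ) (he₁ : e₁ = Pi.single 0 1)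
    (w₁ : Fin (m + 1) → ℂ) (hw₁ : w₁ = (nu⁻¹ : ℝ) • (Fin.cons 0 (v ⟨0, hn⟩) : Fin (m + 1) → ℂ))
    (w₃ : Fin (m + 1) → ℂ) (hw₃ : w₃ = ((nu ^ 3)⁻¹ : ℝ) • (Fin.cons 0 w : Fin (m + 1) → ℂ))
    (vhat : Fin (m + 1) → ℂ) (hvhat : vhat = e₁ + σ • w₁ + σ ^ 3 • w₃) :
    ‖star vhat ⬝ᵥ e₁‖ ^ 2 / (∑ i, ‖vhat i‖ ^ 2) =
      1 / (1 + σ ^ 2 * (∑ i, ‖v ⟨0, hn⟩ i‖ ^ 2) / nu ^ 2 +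
        2 * σ ^ 4 * (∑ j ∈ Finset.univ.erase ⟨0, hn⟩, ‖star (v ⟨0, hn⟩) ⬝ᵥ v j‖ ^ 2) / nu ^ 4 +
        σ ^ 6 * (∑ i, ‖w i‖ ^ 2) / nu ^ 6) := by
  have h_zero : vhat 0 = 1 := by
    simp [hvhat, he₁, hw₁, hw₃]
  have h_succ (i : Fin m) :
      vhat i.succ = ((σ / nu : ℝ) : ℂ) * v ⟨0, hn⟩ i + ((σ ^ 3 / nu ^ 3 : ℝ) : ℂ) * w i := by
    simp [hvhat, he₁, hw₁, hw₃]
    ring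
  have h_inner : star vhat ⬝ᵥ e₁ = 1 := by
    simp [he₁, h_zero]
  have h_cross := re_star_dotProduct_sum_smul (Finset.univ.erase ⟨0, hn⟩) (v ⟨0, hn⟩) v
  rw [← hw] at h_cross
  rw [h_inner, Fin.sum_univ_succ, h_zero]
  simp only [h_succ]
  rw [sum_norm_sq_real_combination, h_cross, norm_one, one_pow]
  congr 1
  field_simp
  ring
end
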